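/- Let d ≥ 1, T > 0, C₀ > 0, C > 0, and let V : ℝ^d → ℝ be smooth with V(x) ≥ −C₀ for all x and |∂^β V(x)| ≤ C^{|β|+1}β! for all x and all multi-indices β with |β| ≥ 2. Let u₀ : ℝ^d → ℂ be smooth with u₀ and all its derivatives in L², and suppose there exists A > 0 with ‖∂^α u₀‖_{L²} ≤ A^{|α|+1}α! for every multi-index α. Then there exists A' > 0 such that for every t ∈ [0,T] and every multi-index α, ‖∂^α(e^{−tV}u₀)‖_{L²} ≤ A'^{|α|+1}α!, where e^{−tV}u₀ denotes the pointwise product x ↦ e^{−tV(x)}u₀(x). -/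

import Mathlib

open MeasureTheory Complex Filter
open scoped BigOperators RealInnerProductSpace

noncomputable section

/-- Euclidean space `ℝ^d`. -/
abbrev Ed (d : ℕ) : Type := EuclideanSpace ℝ (Fin d)

/-- Partial derivative in the `j`-th coordinate direction. -/
def pd {F : Type*} [NormedAddCommGroup F] [NormedSpace ℝ F]
    (d : ℕ) (j : Fin d) (f : Ed d → F) : Ed d → F :=
  fun x => fderiv ℝ f x (EuclideanSpace.single j 1)

/-- Iterated partial derivative `∂^α` for a multi-index `α : Fin d → ℕ`. -/
def md {F : Type*} [NormedAddCommGroup F] [NormedSpace ℝ F]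
    {d : ℕ} (α : Fin d → ℕ) (f : Ed d → F) : Ed d → F :=
  (List.finRange d).foldr (fun j g => (pd d j)^[α j] g) f

/-- Length `|α| = α₁ + ⋯ + α_d` of a multi-index. -/
def mlen {d : ℕ} (α : Fin d → ℕ) : ℕ := ∑ j, α j

/-- `L²` inner product `⟨f, g⟩ = ∫ f(x) conj(g(x)) dx` (antilinear in the second factor). -/
def ip {d : ℕ} (f g : Ed d → ℂ) : ℂ := ∫ x, f x * (starRingEnd ℂ) (g x)

/-- Square `‖f‖²` of the `L²` norm. -/
def l2sq {d : ℕ} (f : Ed d → ℂ) : ℝ := ∫ x, ‖f x‖ ^ 2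

/-- The factorial `α! = α₁!⋯α_d!` of a multi-index. -/
def mfact {d : ℕ} (α : Fin d → ℕ) : ℕ := ∏ j, Nat.factorial (α j)

/-- The `L²` norm. -/
def l2norm {d : ℕ} (f : Ed d → ℂ) : ℝ := Real.sqrt (∫ x, ‖f x‖ ^ 2)

/-- The composition of partial derivatives `∂_{j₁} ⋯ ∂_{jₖ}` along a list of directions. -/
def listDeriv {F : Type*} [NormedAddCommGroup F] [NormedSpace ℝ F]
    {d : ℕ} (l : List (Fin d)) (f : Ed d → F) : Ed d → F :=
  l.foldr (pd d) f

section PartialDerivatives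

variable {F : Type*} [NormedAddCommGroup F] [NormedSpace ℝ F] {d : ℕ} {f : Ed d → F}

lemma contDiff_pd (hf : ContDiff ℝ (⊤ : ℕ∞) f) (j : Fin d) : ContDiff ℝ (⊤ : ℕ∞) (pd d j f) :=
  (hf.fderiv_right (m := (⊤ : ℕ∞)) (by simp)).clm_apply contDiff_const

lemma contDiff_listDeriv (hf : ContDiff ℝ (⊤ : ℕ∞) f) (l : List (Fin d)) :
    ContDiff ℝ (⊤ : ℕ∞) (listDeriv l f) := by
  induction l with
  | nil => exact hf
  | cons j l ih => exact contDiff_pd ih j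

lemma pd_comm (hf : ContDiff ℝ (⊤ : ℕ∞) f) (i j : Fin d) :
    pd d i (pd d j f) = pd d j (pd d i f) := by
  have hdiff : Differentiable ℝ (fderiv ℝ f) :=
    (hf.fderiv_right (m := (⊤ : ℕ∞)) (by simp)).differentiable (by simp)
  ext x
  have hsymm : IsSymmSndFDerivAt ℝ f x :=
    hf.contDiffAt.isSymmSndFDerivAt (by
      simpa [minSmoothness_of_isRCLikeNormedField] using
        WithTop.coe_le_coe.2 (le_top (a := (2 : ℕ∞))))
  have hpd : ∀ i j : Fin d, pd d i (pd d j f) x =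
      fderiv ℝ (fderiv ℝ f) x (EuclideanSpace.single i 1) (EuclideanSpace.single j 1) := by
    intro i j
    rw [pd, show pd d j f = fun y => fderiv ℝ f y (EuclideanSpace.single j 1) from rfl,
      fderiv_clm_apply (hdiff x) (differentiableAt_const _)]
    simp
  rw [hpd, hpd, hsymm.eq]

lemma listDeriv_perm (hf : ContDiff ℝ (⊤ : ℕ∞) f) {l₁ l₂ : List (Fin d)} (h : l₁.Perm l₂) :
    listDeriv l₁ f = listDeriv l₂ f := by
  induction h with
  | nil => rfl
  | cons j _ ih => exact congrArg (pd d j) ih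
  | swap i j l => exact pd_comm (contDiff_listDeriv hf l) j i
  | trans _ _ ih₁ ih₂ => exact ih₁.trans ih₂

/-- The sorted list of directions in which `∂^α` differentiates. -/
def dirList (α : Fin d → ℕ) : List (Fin d) :=
  (List.finRange d).flatMap fun j => List.replicate (α j) j

lemma md_eq_listDeriv (α : Fin d → ℕ) : md α f = listDeriv (dirList α) f := by
  have hrep : ∀ (n : ℕ) (j : Fin d) (g : Ed d → F),
      (List.replicate n j).foldr (pd d) g = (pd d j)^[n] g := by
    intro n j g
    induction n with
    | zero => rfl
    | succ n ih => rw [List.replicate_succ, List.foldr_cons, ih, Function.iterate_succ_apply']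
  simp only [md, listDeriv, dirList, List.foldr_flatMap, hrep]

lemma length_dirList (α : Fin d → ℕ) : (dirList α).length = mlen α := by
  simp [dirList, mlen, List.length_flatMap, ← List.ofFn_eq_map, List.sum_ofFn]

lemma count_dirList (α : Fin d → ℕ) (j : Fin d) : (dirList α).count j = α j := by
  rw [dirList, List.count_flatMap, ← List.ofFn_eq_map, List.sum_ofFn]
  simp [List.count_replicate]

lemma dirList_count_perm (l : List (Fin d)) : (dirList fun j => l.count j).Perm l :=
  List.perm_iff_count.2 fun j => count_dirList _ j

lemma mlen_count (l : List (Fin d)) : mlen (fun j => l.count j) = l.length := by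
  rw [← length_dirList, (dirList_count_perm l).length_eq]

lemma listDeriv_eq_md (hf : ContDiff ℝ (⊤ : ℕ∞) f) (l : List (Fin d)) :
    listDeriv l f = md (fun j => l.count j) f := by
  rw [md_eq_listDeriv, listDeriv_perm hf (dirList_count_perm l)]

lemma iteratedFDeriv_apply_single (hf : ContDiff ℝ (⊤ : ℕ∞) f) {k : ℕ} (w : Fin k → Fin d)
    (x : Ed d) :
    iteratedFDeriv ℝ k f x (fun i => EuclideanSpace.single (w i) 1) =
      listDeriv (List.ofFn w) f x := by
  induction k generalizing x with
  | zero => simp [listDeriv]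
  | succ k ih =>
    have hdiff : DifferentiableAt ℝ (iteratedFDeriv ℝ k f) x :=
      hf.differentiable_iteratedFDeriv (by exact_mod_cast ENat.natCast_lt_top k) x
    rw [hdiff.iteratedFDeriv_succ_apply_left', List.ofFn_succ]
    have htail : (fun y => iteratedFDeriv ℝ k f y
        (Fin.tail fun i => EuclideanSpace.single (w i) 1)) =
        listDeriv (List.ofFn fun i => w i.succ) f := by
      ext y
      exact ih (fun i => w i.succ) y
    rw [htail]
    rfl

lemma norm_md_le_norm_iteratedFDeriv (hf : ContDiff ℝ (⊤ : ℕ∞) f) (α : Fin d → ℕ) (x : Ed d) :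
    ‖md α f x‖ ≤ ‖iteratedFDeriv ℝ (mlen α) f x‖ := by
  rw [md_eq_listDeriv, ← length_dirList, ← List.ofFn_get (dirList α),
    ← iteratedFDeriv_apply_single hf, List.ofFn_get]
  refine (ContinuousMultilinearMap.le_opNorm _ _).trans ?_
  simp

lemma norm_iteratedFDeriv_le_sum_norm_md (hf : ContDiff ℝ (⊤ : ℕ∞) f) (k : ℕ) (x : Ed d) :
    ‖iteratedFDeriv ℝ k f x‖ ≤
      ∑ w : Fin k → Fin d, ‖md (fun j => (List.ofFn w).count j) f x‖ := by
  refine ContinuousMultilinearMap.opNorm_le_bound (by positivity) fun m => ?_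
  have hm : m = fun i => ∑ j, m i j • EuclideanSpace.single j (1 : ℝ) := by
    ext i j
    simp [Finset.sum_apply, Pi.single_apply]
  conv_lhs => rw [hm, ContinuousMultilinearMap.map_sum]
  rw [Finset.sum_mul]
  refine (norm_sum_le _ _).trans (Finset.sum_le_sum fun w _ => ?_)
  rw [ContinuousMultilinearMap.map_smul_univ, norm_smul, iteratedFDeriv_apply_single hf,
    listDeriv_eq_md hf, norm_prod, mul_comm]
  gcongr with i
  exact PiLp.norm_apply_le _ _

lemma mfact_le_factorial_mlen (α : Fin d → ℕ) : mfact α ≤ (mlen α).factorial :=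
  Nat.le_of_dvd (Nat.factorial_pos _) (Nat.prod_factorial_dvd_factorial_sum _ _)

lemma factorial_mlen_le (α : Fin d → ℕ) :
    (mlen α).factorial ≤ (2 ^ d) ^ mlen α * mfact α := by
  suffices h : ∀ s : Finset (Fin d), (∑ j ∈ s, α j).factorial ≤
      (2 ^ s.card) ^ (∑ j ∈ s, α j) * ∏ j ∈ s, (α j).factorial by
    simpa [mlen, mfact] using h Finset.univ
  intro s
  induction s using Finset.cons_induction_on with
  | empty => simp
  | cons a s ha ih =>
    rw [Finset.sum_cons, Finset.prod_cons, Finset.card_cons]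
    generalize ∑ j ∈ s, α j = n at ih ⊢
    rw [← Nat.choose_mul_factorial_mul_factorial (Nat.le_add_right (α a) n),
      Nat.add_sub_cancel_left]
    calc (α a + n).choose (α a) * (α a).factorial * n.factorial
        ≤ 2 ^ (α a + n) * (α a).factorial * ((2 ^ s.card) ^ n * ∏ j ∈ s, (α j).factorial) := by
          gcongr
          exact Nat.choose_le_two_pow _ _
      _ ≤ 2 ^ (α a + n) * (α a).factorial *
          ((2 ^ s.card) ^ (α a + n) * ∏ j ∈ s, (α j).factorial) := by
          gcongr
          · exact Nat.one_le_two_pow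
          · omega
      _ = (2 ^ (s.card + 1)) ^ (α a + n) * ((α a).factorial * ∏ j ∈ s, (α j).factorial) := by
          rw [pow_succ 2 s.card, mul_pow]
          ring

end PartialDerivatives

section Exponential

lemma le_mul_exp_of_succ_mul_le {e : ℕ → ℝ} {Q : ℝ} (hQ : 0 ≤ Q) (he : ∀ n, 0 ≤ e n)
    (hrec : ∀ n : ℕ, (n + 1) * e (n + 1) ≤ Q * ∑ k ∈ Finset.range (n + 1), e k) (n : ℕ) :
    e n ≤ e 0 * Real.exp (n + Q) := by
  have hsum : ∀ n : ℕ, (n.factorial : ℝ) * ∑ k ∈ Finset.range (n + 1), e k ≤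
      e 0 * (n + Q) ^ n := by
    intro n
    induction n with
    | zero => simp
    | succ n ih =>
      have hstep : (n + 1 : ℝ) * ∑ k ∈ Finset.range (n + 1 + 1), e k ≤
          (n + 1 + Q) * ∑ k ∈ Finset.range (n + 1), e k := by
        rw [Finset.sum_range_succ _ (n + 1)]
        linarith [hrec n]
      push_cast [Nat.factorial_succ]
      calc ((n + 1 : ℝ) * n.factorial) * ∑ k ∈ Finset.range (n + 1 + 1), e k
          = n.factorial * ((n + 1) * ∑ k ∈ Finset.range (n + 1 + 1), e k) := by ring
        _ ≤ n.factorial * ((n + 1 + Q) * ∑ k ∈ Finset.range (n + 1), e k) := by gcongr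
        _ = (n + 1 + Q) * (n.factorial * ∑ k ∈ Finset.range (n + 1), e k) := by ring
        _ ≤ (n + 1 + Q) * (e 0 * (n + Q) ^ n) := by gcongr
        _ ≤ (n + 1 + Q) * (e 0 * (n + 1 + Q) ^ n) := by
            have := he 0
            gcongr
            linarith
        _ = e 0 * (n + 1 + Q) ^ (n + 1) := by ring
  have hle : e n ≤ ∑ k ∈ Finset.range (n + 1), e k :=
    Finset.single_le_sum (fun k _ => he k) (Finset.self_mem_range_succ n)
  have hfact : (0 : ℝ) < n.factorial := by positivity
  calc e n ≤ ∑ k ∈ Finset.range (n + 1), e k := hle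
    _ ≤ e 0 * ((n + Q) ^ n / n.factorial) := by
        rw [← mul_div_assoc, le_div_iff₀ hfact, mul_comm]
        exact hsum n
    _ ≤ e 0 * Real.exp (n + Q) := by
        have := he 0
        gcongr
        exact Real.pow_div_factorial_le_exp _ (by positivity) n

variable {E : Type*} [NormedAddCommGroup E] [NormedSpace ℝ E]

lemma norm_iteratedFDeriv_exp_le {φ : E → ℝ} (hφ : ContDiff ℝ (⊤ : ℕ∞) φ) {x : E} {Q R : ℝ}
    (hQ : 0 ≤ Q) (hR : 1 ≤ R)
    (hbound : ∀ i, ‖iteratedFDeriv ℝ (i + 1) φ x‖ ≤ Q * R ^ i * i.factorial) (n : ℕ) :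
    ‖iteratedFDeriv ℝ n (fun y => Real.exp (φ y)) x‖ ≤
      Real.exp (φ x + Q) * (Real.exp 1 * R) ^ n * n.factorial := by
  have hR0 : 0 < R := by linarith
  set G : E → ℝ := fun y => Real.exp (φ y) with hG
  set e : ℕ → ℝ := fun n => ‖iteratedFDeriv ℝ n G x‖ / (R ^ n * n.factorial) with he
  have hGe : ∀ n, ‖iteratedFDeriv ℝ n G x‖ = e n * (R ^ n * n.factorial) := by
    intro n
    rw [he]
    field_simp
  have hderiv : fderiv ℝ G = fun y => G y • fderiv ℝ φ y := by
    ext1 y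
    exact fderiv_exp (hφ.differentiable (by simp) y)
  have hrec : ∀ n : ℕ, (n + 1) * e (n + 1) ≤ Q * ∑ k ∈ Finset.range (n + 1), e k := by
    intro n
    have hleib : ‖iteratedFDeriv ℝ (n + 1) G x‖ ≤
        Q * (R ^ n * n.factorial) * ∑ k ∈ Finset.range (n + 1), e k := by
      rw [← norm_iteratedFDeriv_fderiv, hderiv]
      refine (norm_iteratedFDeriv_smul_le (N := (⊤ : ℕ∞)) hφ.exp
        (hφ.fderiv_right (by simp)) x (by exact_mod_cast le_top)).trans ?_
      rw [Finset.mul_sum]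
      refine Finset.sum_le_sum fun k hk => ?_
      have hkn : k ≤ n := Nat.lt_succ_iff.1 (Finset.mem_range.1 hk)
      rw [norm_iteratedFDeriv_fderiv]
      have hek : 0 ≤ e k := by positivity
      calc (n.choose k : ℝ) * ‖iteratedFDeriv ℝ k G x‖ * ‖iteratedFDeriv ℝ (n - k + 1) φ x‖
          ≤ (n.choose k : ℝ) * (e k * (R ^ k * k.factorial)) *
            (Q * R ^ (n - k) * (n - k).factorial) := by
            rw [hGe]
            gcongr
            exact hbound _
        _ = Q * (R ^ (k + (n - k)) *
            ((n.choose k * k.factorial * (n - k).factorial : ℕ) : ℝ)) * e k := by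
            push_cast
            ring
        _ = Q * (R ^ n * n.factorial) * e k := by
            rw [Nat.choose_mul_factorial_mul_factorial hkn, Nat.add_sub_cancel' hkn]
    have hS : 0 ≤ ∑ k ∈ Finset.range (n + 1), e k :=
      Finset.sum_nonneg fun k _ => by positivity
    rw [hGe, Nat.factorial_succ] at hleib
    push_cast at hleib
    have hpos : 0 < R ^ n * (n.factorial : ℝ) := by positivity
    have hen : 0 ≤ e (n + 1) := by positivity
    refine le_of_mul_le_mul_left ?_ hpos
    calc R ^ n * n.factorial * ((n + 1) * e (n + 1))
        ≤ R * (R ^ n * n.factorial * ((n + 1) * e (n + 1))) :=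
          le_mul_of_one_le_left (by positivity) hR
      _ = e (n + 1) * (R ^ (n + 1) * ((n + 1) * n.factorial)) := by ring
      _ ≤ _ := hleib
      _ = _ := by ring
  have hmain := le_mul_exp_of_succ_mul_le hQ (fun n => by positivity) hrec n
  have he0 : e 0 = Real.exp (φ x) := by simp [he, hG]
  rw [hGe]
  calc e n * (R ^ n * n.factorial)
      ≤ Real.exp (φ x) * Real.exp (n + Q) * (R ^ n * n.factorial) := by
        rw [← he0]
        gcongr
    _ = Real.exp (φ x + Q) * (Real.exp 1 * R) ^ n * n.factorial := by
        rw [mul_pow, ← Real.exp_nat_mul, mul_one, Real.exp_add, Real.exp_add]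
        ring

lemma norm_fderiv_le_add_of_le {V : E → ℝ} {m M : ℝ} (hV : ContDiff ℝ 2 V) (hm : ∀ x, m ≤ V x)
    (hM : ∀ x, ‖iteratedFDeriv ℝ 2 V x‖ ≤ M) (x : E) : ‖fderiv ℝ V x‖ ≤ V x - m + M := by
  have hdV : Differentiable ℝ V := hV.differentiable (by simp)
  have hddV : Differentiable ℝ (fderiv ℝ V) :=
    (hV.fderiv_right (m := 1) (by norm_num)).differentiable (by simp)
  have hM0 : 0 ≤ M := (norm_nonneg _).trans (hM x)
  have hlip : ∀ y, ‖fderiv ℝ V y - fderiv ℝ V x‖ ≤ M * ‖y - x‖ := fun y =>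
    convex_univ.norm_image_sub_le_of_norm_fderiv_le (𝕜 := ℝ) (fun z _ => hddV z)
      (fun z _ => by
        rw [← norm_iteratedFDeriv_one, norm_iteratedFDeriv_fderiv]
        exact hM z) (Set.mem_univ x) (Set.mem_univ y)
  have htaylor : ∀ h : E, ‖h‖ = 1 → -fderiv ℝ V x h ≤ V x - m + M := by
    intro h hh
    have hball : ∀ z ∈ Metric.closedBall x 1, ‖fderiv ℝ V z - fderiv ℝ V x‖ ≤ M := by
      intro z hz
      refine (hlip z).trans (mul_le_of_le_one_right hM0 ?_)
      rwa [← dist_eq_norm]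
    have hdiff := (convex_closedBall x 1).norm_image_sub_le_of_norm_fderiv_le' (𝕜 := ℝ)
      (fun z _ => hdV z) hball (Metric.mem_closedBall_self zero_le_one)
      (show x + h ∈ Metric.closedBall x 1 by simp [hh])
    rw [add_sub_cancel_left, hh, mul_one, Real.norm_eq_abs] at hdiff
    linarith [(abs_le.1 hdiff).2, hm (x + h)]
  refine ContinuousLinearMap.opNorm_le_of_unit_norm (by linarith [hm x]) fun h hh => ?_
  rw [Real.norm_eq_abs, abs_le']
  refine ⟨?_, htaylor h hh⟩
  simpa using htaylor (-h) (by rwa [norm_neg])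

end Exponential

section SquareIntegrable

variable {d : ℕ}

lemma norm_iteratedFDeriv_le_of_norm_md_le {F : Type*} [NormedAddCommGroup F] [NormedSpace ℝ F]
    {f : Ed d → F} (hf : ContDiff ℝ (⊤ : ℕ∞) f) {k : ℕ} {x : Ed d} {b : ℝ}
    (hb : ∀ α : Fin d → ℕ, mlen α = k → ‖md α f x‖ ≤ b) :
    ‖iteratedFDeriv ℝ k f x‖ ≤ d ^ k * b := by
  refine (norm_iteratedFDeriv_le_sum_norm_md hf k x).trans ?_
  refine (Finset.sum_le_card_nsmul _ _ b fun w _ => hb _ ?_).trans ?_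
  · rw [mlen_count, List.length_ofFn]
  · simp

lemma integral_norm_sq_iteratedFDeriv_le {f : Ed d → ℂ} (hf : ContDiff ℝ (⊤ : ℕ∞) f) {A : ℝ}
    (hA : 0 ≤ A) (hL2 : ∀ α : Fin d → ℕ, Integrable fun x => ‖md α f x‖ ^ 2)
    (hbound : ∀ α : Fin d → ℕ, l2norm (md α f) ≤ A ^ (mlen α + 1) * (mfact α : ℝ)) (k : ℕ) :
    Integrable (fun x => ‖iteratedFDeriv ℝ k f x‖ ^ 2) ∧
      ∫ x, ‖iteratedFDeriv ℝ k f x‖ ^ 2 ≤ (A * (d * A) ^ k * k.factorial) ^ 2 := by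
  set g : Ed d → ℝ := fun x =>
    d ^ k * ∑ w : Fin k → Fin d, ‖md (fun j => (List.ofFn w).count j) f x‖ ^ 2 with hg
  have hgint : Integrable g :=
    (integrable_finsetSum _ fun w _ => hL2 fun j => (List.ofFn w).count j).const_mul _
  have hle : ∀ x, ‖iteratedFDeriv ℝ k f x‖ ^ 2 ≤ g x := by
    intro x
    calc ‖iteratedFDeriv ℝ k f x‖ ^ 2
        ≤ (∑ w : Fin k → Fin d, ‖md (fun j => (List.ofFn w).count j) f x‖) ^ 2 := by
          gcongr
          exact norm_iteratedFDeriv_le_sum_norm_md hf k x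
      _ ≤ _ := sq_sum_le_card_mul_sum_sq
      _ = g x := by simp [hg]
  have hcont : Continuous fun x => ‖iteratedFDeriv ℝ k f x‖ ^ 2 :=
    (hf.continuous_iteratedFDeriv (by exact_mod_cast le_top)).norm.pow 2
  have hmd : ∀ w : Fin k → Fin d, ∫ x, ‖md (fun j => (List.ofFn w).count j) f x‖ ^ 2 ≤
      (A ^ (k + 1) * k.factorial) ^ 2 := by
    intro w
    have hw := hbound fun j => (List.ofFn w).count j
    have hfact := mfact_le_factorial_mlen fun j => (List.ofFn w).count j
    rw [mlen_count, List.length_ofFn] at hw hfact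
    refine (Real.sqrt_le_left (by positivity)).1 (hw.trans ?_)
    gcongr
  refine ⟨hgint.mono' hcont.aestronglyMeasurable (ae_of_all _ fun x => ?_), ?_⟩
  · rw [Real.norm_of_nonneg (by positivity)]
    exact hle x
  calc ∫ x, ‖iteratedFDeriv ℝ k f x‖ ^ 2
      ≤ ∫ x, g x := integral_mono_of_nonneg (ae_of_all _ fun x => by positivity) hgint
        (ae_of_all _ hle)
    _ = d ^ k * ∑ w : Fin k → Fin d, ∫ x, ‖md (fun j => (List.ofFn w).count j) f x‖ ^ 2 := by
        rw [hg, integral_const_mul, integral_finsetSum _ fun w _ => hL2 _]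
    _ ≤ d ^ k * ∑ _w : Fin k → Fin d, (A ^ (k + 1) * k.factorial) ^ 2 := by
        gcongr with w
        exact hmd w
    _ = (A * (d * A) ^ k * k.factorial) ^ 2 := by
        simp only [Finset.sum_const, Finset.card_univ, Fintype.card_fun, Fintype.card_fin,
          nsmul_eq_mul, Nat.cast_pow]
        ring

lemma l2norm_md_smul_le {G : Ed d → ℝ} {u : Ed d → ℂ} (hG : ContDiff ℝ (⊤ : ℕ∞) G)
    (hu : ContDiff ℝ (⊤ : ℕ∞) u) {K A D : ℝ} (hK : 0 ≤ K) (hA : 0 ≤ A) (hD : 0 ≤ D)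
    (hGbound : ∀ n x, ‖iteratedFDeriv ℝ n G x‖ ≤ K * D ^ n * n.factorial)
    (huint : ∀ n, Integrable fun x => ‖iteratedFDeriv ℝ n u x‖ ^ 2)
    (hubound : ∀ n, ∫ x, ‖iteratedFDeriv ℝ n u x‖ ^ 2 ≤ (A * D ^ n * n.factorial) ^ 2)
    (α : Fin d → ℕ) :
    l2norm (md α fun x => G x • u x) ≤
      (mlen α + 1) * (K * A * D ^ mlen α * (mlen α).factorial) := by
  generalize hn : mlen α = n
  set b : ℕ → ℝ := fun k => K * D ^ k * (n.choose k * k.factorial) with hb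
  set g : Ed d → ℝ := fun x =>
    (n + 1) * ∑ k ∈ Finset.range (n + 1), b k ^ 2 * ‖iteratedFDeriv ℝ (n - k) u x‖ ^ 2 with hg
  have hgint : Integrable g :=
    (integrable_finsetSum _ fun k _ => (huint (n - k)).const_mul _).const_mul _
  have hle : ∀ x, ‖md α (fun x => G x • u x) x‖ ^ 2 ≤ g x := by
    intro x
    have hleib : ‖md α (fun x => G x • u x) x‖ ≤
        ∑ k ∈ Finset.range (n + 1), b k * ‖iteratedFDeriv ℝ (n - k) u x‖ := by
      refine (norm_md_le_norm_iteratedFDeriv (hG.smul hu) α x).trans ?_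
      rw [hn]
      refine (norm_iteratedFDeriv_smul_le (N := (⊤ : ℕ∞)) hG hu x
        (by exact_mod_cast le_top)).trans (Finset.sum_le_sum fun k _ => ?_)
      gcongr
      calc (n.choose k : ℝ) * ‖iteratedFDeriv ℝ k G x‖
          ≤ n.choose k * (K * D ^ k * k.factorial) := by
            gcongr
            exact hGbound k x
        _ = b k := by ring
    calc ‖md α (fun x => G x • u x) x‖ ^ 2
        ≤ (∑ k ∈ Finset.range (n + 1), b k * ‖iteratedFDeriv ℝ (n - k) u x‖) ^ 2 := by gcongr
      _ ≤ _ := sq_sum_le_card_mul_sum_sq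
      _ = g x := by simp [hg, mul_pow]
  refine Real.sqrt_le_iff.2 ⟨by positivity, ?_⟩
  calc ∫ x, ‖md α (fun x => G x • u x) x‖ ^ 2
      ≤ ∫ x, g x := integral_mono_of_nonneg (ae_of_all _ fun x => by positivity) hgint
        (ae_of_all _ hle)
    _ = (n + 1) * ∑ k ∈ Finset.range (n + 1),
          b k ^ 2 * ∫ x, ‖iteratedFDeriv ℝ (n - k) u x‖ ^ 2 := by
        rw [hg, integral_const_mul,
          integral_finsetSum _ fun k _ => (huint (n - k)).const_mul _]
        simp only [integral_const_mul]
    _ ≤ (n + 1) * ∑ k ∈ Finset.range (n + 1), (K * A * D ^ n * n.factorial) ^ 2 := by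
        gcongr with k hk
        have hkn : k ≤ n := Nat.lt_succ_iff.1 (Finset.mem_range.1 hk)
        calc b k ^ 2 * ∫ x, ‖iteratedFDeriv ℝ (n - k) u x‖ ^ 2
            ≤ b k ^ 2 * (A * D ^ (n - k) * (n - k).factorial) ^ 2 := by
              gcongr
              exact hubound _
          _ = (K * A * D ^ (k + (n - k)) *
              ((n.choose k * k.factorial * (n - k).factorial : ℕ) : ℝ)) ^ 2 := by
              push_cast
              ring
          _ = (K * A * D ^ n * n.factorial) ^ 2 := by
              rw [Nat.choose_mul_factorial_mul_factorial hkn, Nat.add_sub_cancel' hkn]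
    _ = ((n + 1) * (K * A * D ^ n * n.factorial)) ^ 2 := by
        rw [Finset.sum_const, Finset.card_range, nsmul_eq_mul]
        push_cast
        ring

end SquareIntegrable

/-- If `V` is bounded below and its derivatives of order at least two obey analytic bounds, then
the derivatives of `e^{-tV}` obey analytic bounds that are uniform in space and in `t ∈ [0, T]`. -/
lemma norm_iteratedFDeriv_exp_neg_mul_le {d : ℕ} {T C₀ C : ℝ} (hC : 0 < C)
    (hC₀ : 0 < C₀) {V : Ed d → ℝ} (hV : ContDiff ℝ (⊤ : ℕ∞) V) (hVlower : ∀ x, -C₀ ≤ V x)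
    (hVbd : ∀ β : Fin d → ℕ, 2 ≤ mlen β → ∀ x,
      |md β V x| ≤ C ^ (mlen β + 1) * (mfact β : ℝ)) {t : ℝ} (ht : t ∈ Set.Icc 0 T)
    (n : ℕ) (x : Ed d) :
    ‖iteratedFDeriv ℝ n (fun y => Real.exp (-(t * V y))) x‖ ≤
      Real.exp (T * (C₀ + 2 * d ^ 2 * C ^ 3 + d * C ^ 2)) *
        (Real.exp 1 * (1 + 2 * d * C)) ^ n * n.factorial := by
  have hVk : ∀ k, 2 ≤ k → ∀ x, ‖iteratedFDeriv ℝ k V x‖ ≤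
      d ^ k * (C ^ (k + 1) * k.factorial) := fun k hk x =>
    norm_iteratedFDeriv_le_of_norm_md_le hV fun α hα => by
      have hα' := hVbd α (hα ▸ hk) x
      have hfact := mfact_le_factorial_mlen α
      rw [hα] at hα' hfact
      rw [Real.norm_eq_abs]
      refine hα'.trans ?_
      gcongr
  have hgrad : ‖fderiv ℝ V x‖ ≤ V x - -C₀ + 2 * d ^ 2 * C ^ 3 :=
    norm_fderiv_le_add_of_le (hV.of_le (WithTop.coe_le_coe.2 (le_top (a := (2 : ℕ∞)))))
      hVlower (fun x => (hVk 2 le_rfl x).trans_eq (by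
        rw [Nat.factorial_two]
        push_cast
        ring)) x
  have ht0 := ht.1
  have hφ : ContDiff ℝ (⊤ : ℕ∞) fun y => -(t * V y) := (contDiff_const.mul hV).neg
  have hbound : ∀ i, ‖iteratedFDeriv ℝ (i + 1) (fun y => -(t * V y)) x‖ ≤
      t * (‖fderiv ℝ V x‖ + d * C ^ 2) * (1 + 2 * d * C) ^ i * i.factorial := by
    intro i
    have hsmul : ‖iteratedFDeriv ℝ (i + 1) (fun y => -(t * V y)) x‖ =
        t * ‖iteratedFDeriv ℝ (i + 1) V x‖ := by
      have := iteratedFDeriv_const_smul_apply' (𝕜 := ℝ) (i := i + 1) (a := -t) (x := x)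
        (hV.contDiffAt.of_le (by exact_mod_cast le_top))
      simp only [smul_eq_mul, neg_mul] at this
      rw [this, norm_smul, norm_neg, Real.norm_of_nonneg ht0]
    rw [hsmul, mul_assoc, mul_assoc]
    gcongr
    rcases Nat.eq_zero_or_pos i with rfl | hi
    · rw [zero_add, norm_iteratedFDeriv_one]
      simp
      positivity
    · have hi2 : (i + 1 : ℝ) ≤ 2 ^ i := by exact_mod_cast Nat.lt_two_pow_self
      calc ‖iteratedFDeriv ℝ (i + 1) V x‖
          ≤ d ^ (i + 1) * (C ^ (i + 1 + 1) * (i + 1).factorial) := hVk _ (by omega) x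
        _ = d * C ^ 2 * ((i + 1) * (d * C) ^ i * i.factorial) := by
            rw [Nat.factorial_succ]
            push_cast
            ring
        _ ≤ d * C ^ 2 * (2 ^ i * (d * C) ^ i * i.factorial) := by gcongr
        _ = d * C ^ 2 * ((2 * d * C) ^ i * i.factorial) := by ring
        _ ≤ (‖fderiv ℝ V x‖ + d * C ^ 2) * ((1 + 2 * d * C) ^ i * i.factorial) := by
            gcongr
            · linarith [norm_nonneg (fderiv ℝ V x)]
            · linarith
  refine (norm_iteratedFDeriv_exp_le hφ (by positivity)
    (by linarith [show 0 ≤ 2 * d * C by positivity]) hbound n).trans ?_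
  gcongr
  calc -(t * V x) + t * (‖fderiv ℝ V x‖ + d * C ^ 2)
      = t * (‖fderiv ℝ V x‖ - V x + d * C ^ 2) := by ring
    _ ≤ t * (C₀ + 2 * d ^ 2 * C ^ 3 + d * C ^ 2) := by
        gcongr
        linarith
    _ ≤ T * (C₀ + 2 * d ^ 2 * C ^ 3 + d * C ^ 2) := by
        gcongr
        exact ht.2

/-- Multiplication by `e^{-tV}`, the propagator of `∂ₜ + V`, preserves the class `𝒜`
of analytic-type functions when `V` is analytic (Section 6, model case). -/
theorem statement17 (d : ℕ) (hd : 1 ≤ d) (T : ℝ) (hT : 0 < T)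
    (C₀ C : ℝ) (hC₀ : 0 < C₀) (hC : 0 < C)
    (V : Ed d → ℝ) (hVsmooth : ContDiff ℝ (⊤ : ℕ∞) V)
    (hVlower : ∀ x, -C₀ ≤ V x)
    (hVbd : ∀ β : Fin d → ℕ, 2 ≤ mlen β → ∀ x,
      |md β V x| ≤ C ^ (mlen β + 1) * (mfact β : ℝ))
    (u₀ : Ed d → ℂ) (hu₀smooth : ContDiff ℝ (⊤ : ℕ∞) u₀)
    (hu₀L2 : ∀ α : Fin d → ℕ, Integrable (fun x => ‖md α u₀ x‖ ^ 2))
    (A : ℝ) (hA : 0 < A)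
    (hu₀an : ∀ α : Fin d → ℕ, l2norm (md α u₀) ≤ A ^ (mlen α + 1) * (mfact α : ℝ)) :
    ∃ A' > (0 : ℝ), ∀ t ∈ Set.Icc (0:ℝ) T, ∀ α : Fin d → ℕ,
      l2norm (md α (fun x => ((Real.exp (-(t * V x)) : ℝ) : ℂ) * u₀ x))
        ≤ A' ^ (mlen α + 1) * (mfact α : ℝ) := by
  set K := Real.exp (T * (C₀ + 2 * d ^ 2 * C ^ 3 + d * C ^ 2)) with hK
  set D := Real.exp 1 * (1 + 2 * d * C) + d * A with hD
  have hK0 : 0 < K := Real.exp_pos _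
  have hD1 : 1 ≤ D := by
    have h1 : 1 ≤ Real.exp 1 * (1 + 2 * d * C) :=
      one_le_mul_of_one_le_of_one_le (Real.one_le_exp zero_le_one)
        (by linarith [show 0 ≤ 2 * d * C by positivity])
    linarith [show 0 ≤ d * A by positivity]
  have hD0 : 0 < D := by linarith
  have hu := integral_norm_sq_iteratedFDeriv_le hu₀smooth hA.le hu₀L2 hu₀an
  refine ⟨(1 + K * A) * (2 * D * 2 ^ d), by positivity, fun t ht α => ?_⟩
  have hGsmooth : ContDiff ℝ (⊤ : ℕ∞) fun x => Real.exp (-(t * V x)) :=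
    (contDiff_const.mul hVsmooth).neg.exp
  have hprod := l2norm_md_smul_le (K := K) (A := A) (D := D) hGsmooth hu₀smooth hK0.le hA.le
    hD0.le
    (fun n x => (norm_iteratedFDeriv_exp_neg_mul_le hC hC₀ hVsmooth hVlower hVbd ht n x).trans
      (by
        gcongr
        linarith [show 0 ≤ d * A by positivity]))
    (fun n => (hu n).1)
    (fun n => (hu n).2.trans (by
      gcongr
      linarith [show 0 ≤ Real.exp 1 * (1 + 2 * d * C) by positivity])) α
  simp only [Complex.real_smul] at hprod
  refine hprod.trans ?_
  have hfact : ((mlen α).factorial : ℝ) ≤ (2 ^ d) ^ mlen α * mfact α := by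
    exact_mod_cast factorial_mlen_le α
  have hlen : (mlen α + 1 : ℝ) ≤ 2 ^ mlen α := by exact_mod_cast Nat.lt_two_pow_self
  have hfac1 : 1 ≤ 1 + K * A := by linarith [mul_pos hK0 hA]
  have hfac2 : 1 ≤ 2 * D * 2 ^ d :=
    one_le_mul_of_one_le_of_one_le (by linarith) (one_le_pow₀ one_le_two)
  calc (mlen α + 1 : ℝ) * (K * A * D ^ mlen α * (mlen α).factorial)
      ≤ 2 ^ mlen α * (K * A * D ^ mlen α * ((2 ^ d) ^ mlen α * mfact α)) := by gcongr
    _ = K * A * (2 * D * 2 ^ d) ^ mlen α * mfact α := by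
        rw [mul_pow _ ((2 : ℝ) ^ d), mul_pow 2 D]
        ring
    _ ≤ (1 + K * A) ^ (mlen α + 1) * (2 * D * 2 ^ d) ^ (mlen α + 1) * mfact α := by
        gcongr
        · exact le_trans (by linarith) (le_self_pow₀ hfac1 (Nat.succ_ne_zero _))
        · exact Nat.le_succ _
    _ = ((1 + K * A) * (2 * D * 2 ^ d)) ^ (mlen α + 1) * mfact α := by rw [← mul_pow]
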